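/- arXiv:2005.08464 — 3 statements merged into one kernel-verified Lean document; each statement's English description precedes it below -/
import Mathlib

section
/- The characters of the Dunkl–Ramirez hypergroup H_a satisfy the orthogonality relations: for all m, n ∈ ℕ₀, Σ_{k ∈ ℕ₀} χ_n(k) χ_m(k) aᵏ(1−a) = 0 if m ≠ n, and Σ_{k ∈ ℕ₀} χ_n(k)² aᵏ(1−a) = 1/ω(n) if m = n (i.e., the sum equals 1 when n = 0 and aⁿ/(1−a) when n ≥ 1). -/
open Real ENNReal

/-- Characters of the Dunkl–Ramirez hypergroup `H_a` (indexed by `ℕ`, evaluated on `ℕ`):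
`χ_0 ≡ 1`, and for `n ≥ 1`: `χ_n(k) = 0` if `k < n-1`, `χ_n(n-1) = a/(a-1)`,
`χ_n(k) = 1` if `k ≥ n`. -/
noncomputable def chiDR (a : ℝ) (n k : ℕ) : ℝ :=
  if k + 1 < n then 0 else if k + 1 = n then a / (a - 1) else 1

/-- Fourier coefficient on the Dunkl–Ramirez hypergroup `H_a`:
`f̂(n) = Σ_k f(k) χ_n(k) aᵏ (1-a)`. -/
noncomputable def fourierCoeffDR (a : ℝ) (f : ℕ → ℂ) (n : ℕ) : ℂ :=
  ∑' k : ℕ, f k * (chiDR a n k : ℂ) * ((a ^ k * (1 - a) : ℝ) : ℂ)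

/-- The `L^p(H_a)` norm (valued in `ℝ≥0∞`):
`‖f‖_{L^p(H_a)} = (Σ_k |f(k)|^p aᵏ (1-a))^{1/p}`. -/
noncomputable def lpNormDR (a p : ℝ) (f : ℕ → ℂ) : ℝ≥0∞ :=
  (∑' k : ℕ, (ENNReal.ofReal ‖f k‖) ^ p * ENNReal.ofReal (a ^ k * (1 - a))) ^ (1 / p)

/-- Sum of a step function against the Haar weights. -/
lemma step_sum_DR (a : ℝ) (ha0 : 0 < a) (ha : a ≤ 1 / 2) (N : ℕ) (c : ℝ) (g : ℕ → ℝ)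
    (h0 : ∀ k, k < N → g k = 0) (h1 : g N = c) (h2 : ∀ k, N < k → g k = 1) :
    ∑' k : ℕ, g k * (a ^ k * (1 - a)) = c * (a ^ N * (1 - a)) + a ^ (N + 1) := by
  have hne : (1 - a) ≠ 0 := by linarith
  have hs : HasSum (fun k : ℕ => g (k + (N + 1)) * (a ^ (k + (N + 1)) * (1 - a)))
      (a ^ (N + 1)) := by
    have h := (hasSum_geometric_of_lt_one ha0.le (by linarith : a < 1)).mul_left
      (a ^ (N + 1) * (1 - a))
    rw [mul_inv_cancel_right₀ hne] at h
    have hf : (fun k : ℕ => g (k + (N + 1)) * (a ^ (k + (N + 1)) * (1 - a))) =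
        fun i => a ^ (N + 1) * (1 - a) * a ^ i := by
      funext k
      rw [h2 _ (by omega)]
      ring
    rw [hf]
    exact h
  have h := (hasSum_nat_add_iff
    (f := fun k : ℕ => g k * (a ^ k * (1 - a))) (N + 1)).1 hs
  rw [h.tsum_eq, Finset.sum_range_succ, Finset.sum_eq_zero, h1]
  · ring
  · intro k hk
    rw [h0 k (Finset.mem_range.1 hk), zero_mul]

lemma orth_lt_DR (a : ℝ) (ha0 : 0 < a) (ha : a ≤ 1 / 2) (m n : ℕ) (h : m < n) :
    ∑' k : ℕ, chiDR a n k * chiDR a m k * (a ^ k * (1 - a)) = 0 := by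
  obtain ⟨N, rfl⟩ : ∃ N, n = N + 1 := ⟨n - 1, by omega⟩
  have hne : a - 1 ≠ 0 := by linarith
  rw [step_sum_DR a ha0 ha N (a / (a - 1)) (fun k => chiDR a (N + 1) k * chiDR a m k)]
  · field_simp
    ring
  · intro k hk
    simp [chiDR, hk]
  · have e1 : ¬ (N + 1 < m) := by omega
    have e2 : N + 1 ≠ m := by omega
    simp [chiDR, e1, e2]
  · intro k hk
    have e1 : ¬ (k + 1 < m) := by omega
    have e2 : k + 1 ≠ m := by omega
    have e3 : ¬ (k < N) := by omega
    have e4 : k ≠ N := by omega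
    simp [chiDR, e1, e2, e3, e4]

/-- **Orthogonality relations for the characters of the Dunkl–Ramirez hypergroup `H_a`.**
For all `m, n`: `Σ_k χ_n(k) χ_m(k) aᵏ(1-a) = 0` if `m ≠ n`, and
`Σ_k χ_n(k)² aᵏ(1-a) = 1/ω(n)`, i.e. `1` when `n = 0` and `aⁿ/(1-a)` when `n ≥ 1`. -/
theorem orthogonality_dunkl_ramirez
    (a : ℝ) (ha0 : 0 < a) (ha : a ≤ 1 / 2) :
    (∀ m n : ℕ, m ≠ n →
        ∑' k : ℕ, chiDR a n k * chiDR a m k * (a ^ k * (1 - a)) = 0) ∧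
      (∀ n : ℕ, ∑' k : ℕ, (chiDR a n k) ^ 2 * (a ^ k * (1 - a)) =
        if n = 0 then 1 else a ^ n / (1 - a)) := by
  refine ⟨?_, ?_⟩
  · intro m n hmn
    rcases lt_or_gt_of_ne hmn with h | h
    · exact orth_lt_DR a ha0 ha m n h
    · rw [← orth_lt_DR a ha0 ha n m h]
      exact tsum_congr fun k => by ring
  · intro n
    have hne : a - 1 ≠ 0 := by linarith
    have hne2 : 1 - a ≠ 0 := by linarith
    rcases n with _ | N
    · rw [step_sum_DR a ha0 ha 0 1 (fun k => (chiDR a 0 k) ^ 2)]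
      · simp
      · intro k hk
        omega
      · simp [chiDR]
      · intro k hk
        simp [chiDR]
    · rw [step_sum_DR a ha0 ha N ((a / (a - 1)) ^ 2) (fun k => (chiDR a (N + 1) k) ^ 2)]
      · have e : a - 1 = -(1 - a) := by ring
        rw [if_neg (Nat.succ_ne_zero N), e]
        field_simp
        ring
      · intro k hk
        simp [chiDR, hk]
      · simp [chiDR]
      · intro k hk
        have e3 : ¬ (k < N) := by omega
        have e4 : k ≠ N := by omega
        simp [chiDR, e3, e4]
end

section
/- For every f : ℕ₀ → ℂ with Σ_{k ∈ ℕ₀} |f(k)|² aᵏ(1−a) < ∞, one has the Plancherel identity |f̂(0)|² + Σ_{n ≥ 1} (1−a) a^{−n} |f̂(n)|² = Σ_{k ∈ ℕ₀} |f(k)|² aᵏ(1−a). (Plancherel theorem on the Dunkl–Ramirez hypergroup H_a.) -/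
open Real ENNReal

/-- Weighted tail of `f` from index `n` on. -/
noncomputable def tailDR (a : ℝ) (f : ℕ → ℂ) (n : ℕ) : ℂ :=
  ∑' k : ℕ, f (k + n) * ((a ^ (k + n) * (1 - a) : ℝ) : ℂ)

lemma tailDR_step (a : ℝ) (f : ℕ → ℂ)
    (hs : Summable fun k => f k * ((a ^ k * (1 - a) : ℝ) : ℂ)) (n : ℕ) :
    tailDR a f n = f n * ((a ^ n * (1 - a) : ℝ) : ℂ) + tailDR a f (n + 1) := by
  have h := (summable_nat_add_iff n).2 hs
  have := h.tsum_eq_zero_add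
  unfold tailDR
  rw [this]
  simp only [zero_add, add_assoc, add_comm 1 n]

lemma fourier_zeroDR (a : ℝ) (f : ℕ → ℂ) : fourierCoeffDR a f 0 = tailDR a f 0 := by
  unfold fourierCoeffDR tailDR
  simp [chiDR]

lemma fourier_succDR (a : ℝ) (ha : a < 1) (f : ℕ → ℂ)
    (hs : Summable fun k => f k * ((a ^ k * (1 - a) : ℝ) : ℂ)) (n : ℕ) :
    fourierCoeffDR a f (n + 1) = tailDR a f (n + 1) - (a : ℂ) * (f n * ((a ^ n : ℝ) : ℂ)) := by
  have h1 : ∀ k, f (k + (n + 1)) * (chiDR a (n + 1) (k + (n + 1)) : ℂ) *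
      ((a ^ (k + (n + 1)) * (1 - a) : ℝ) : ℂ)
      = f (k + (n + 1)) * ((a ^ (k + (n + 1)) * (1 - a) : ℝ) : ℂ) := by
    intro k
    have : chiDR a (n + 1) (k + (n + 1)) = 1 := by
      unfold chiDR
      rw [if_neg (by omega), if_neg (by omega)]
    rw [this]; simp
  have hs' : Summable fun k => f k * (chiDR a (n + 1) k : ℂ) * ((a ^ k * (1 - a) : ℝ) : ℂ) := by
    rw [← summable_nat_add_iff (n + 1)]
    simp only [h1]
    exact (summable_nat_add_iff (n + 1)).2 hs
  unfold fourierCoeffDR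
  rw [← hs'.sum_add_tsum_nat_add (n + 1)]
  simp only [h1]
  rw [Finset.sum_range_succ, Finset.sum_eq_zero]
  · have h2 : chiDR a (n + 1) n = a / (a - 1) := by
      unfold chiDR
      rw [if_neg (by omega), if_pos rfl]
    rw [h2]
    unfold tailDR
    have h3 : (a : ℂ) - 1 ≠ 0 := by
      have : a - 1 ≠ 0 := by linarith
      exact_mod_cast this
    have h4 : f n * ((a / (a - 1) : ℝ) : ℂ) * ((a ^ n * (1 - a) : ℝ) : ℂ)
        = - ((a : ℂ) * (f n * ((a ^ n : ℝ) : ℂ))) := by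
      push_cast
      field_simp
      ring
    rw [h4]; ring
  · intro k hk
    have := Finset.mem_range.1 hk
    have h2 : chiDR a (n + 1) k = 0 := by
      unfold chiDR
      rw [if_pos (by omega)]
    rw [h2]; simp

lemma algDR (a : ℝ) (T x : ℂ) :
    a * ‖x * ((1 - a : ℝ) : ℂ) + T‖ ^ 2 + (1 - a) * ‖T - a * x‖ ^ 2
      = ‖T‖ ^ 2 + a * (1 - a) * ‖x‖ ^ 2 := by
  simp only [Complex.sq_norm, Complex.normSq_apply]
  simp
  ring

lemma partialDR (a : ℝ) (ha0 : 0 < a) (ha : a < 1) (f : ℕ → ℂ)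
    (hs : Summable fun k => f k * ((a ^ k * (1 - a) : ℝ) : ℂ)) (N : ℕ) :
    ‖fourierCoeffDR a f 0‖ ^ 2 +
      ∑ n ∈ Finset.range N, (1 - a) / a ^ (n + 1) * ‖fourierCoeffDR a f (n + 1)‖ ^ 2
    = ∑ n ∈ Finset.range N, ‖f n‖ ^ 2 * (a ^ n * (1 - a)) + ‖tailDR a f N‖ ^ 2 / a ^ N := by
  induction N with
  | zero => simp [fourier_zeroDR]
  | succ N ih =>
    rw [Finset.sum_range_succ, Finset.sum_range_succ, ← add_assoc, ih, fourier_succDR a ha f hs,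
      tailDR_step a f hs N]
    have h := algDR a (tailDR a f (N + 1)) (f N * ((a ^ N : ℝ) : ℂ))
    have e : f N * ((a ^ N : ℝ) : ℂ) * ((1 - a : ℝ) : ℂ)
        = f N * ((a ^ N * (1 - a) : ℝ) : ℂ) := by push_cast; ring
    have e2 : ‖f N * ((a ^ N : ℝ) : ℂ)‖ ^ 2 = ‖f N‖ ^ 2 * (a ^ N) ^ 2 := by
      rw [norm_mul, Complex.norm_real, mul_pow, Real.norm_eq_abs, sq_abs]
    rw [e, e2] at h
    have hp : 0 < a ^ N := pow_pos ha0 N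
    generalize ‖f N * ((a ^ N * (1 - a) : ℝ) : ℂ) + tailDR a f (N + 1)‖ = A at *
    generalize ‖tailDR a f (N + 1) - (a : ℂ) * (f N * ((a ^ N : ℝ) : ℂ))‖ = B at *
    generalize ‖tailDR a f (N + 1)‖ = C at *
    rw [pow_succ a N]
    generalize ∑ n ∈ Finset.range N, ‖f n‖ ^ 2 * (a ^ n * (1 - a)) = S at *
    generalize a ^ N = p at *
    field_simp
    linarith

lemma remDR (a : ℝ) (ha0 : 0 < a) (ha : a < 1) (f : ℕ → ℂ)
    (h2 : Summable fun k => ‖f k‖ ^ 2 * (a ^ k * (1 - a)))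
    (h1 : Summable fun k => ‖f k‖ * (a ^ k * (1 - a))) (N : ℕ) :
    ‖tailDR a f N‖ ^ 2 / a ^ N ≤ ∑' k, ‖f (k + N)‖ ^ 2 * (a ^ (k + N) * (1 - a)) := by
  have hp : 0 < a ^ N := pow_pos ha0 N
  have H2 := ((summable_nat_add_iff N).2 h2).hasSum
  have S1 := (summable_nat_add_iff N).2 h1
  have H1 := S1.hasSum
  have H0 : HasSum (fun k => a ^ (k + N) * (1 - a)) (a ^ N) := by
    have := (hasSum_geometric_of_lt_one ha0.le ha).mul_right (a ^ N * (1 - a))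
    have e : (1 - a)⁻¹ * (a ^ N * (1 - a)) = a ^ N := by
      have : 1 - a ≠ 0 := by linarith
      field_simp
    rw [e] at this
    refine this.congr_fun ?_
    intro k; ring
  have hn : ∀ k, ‖f (k + N) * ((a ^ (k + N) * (1 - a) : ℝ) : ℂ)‖
      = ‖f (k + N)‖ * (a ^ (k + N) * (1 - a)) := by
    intro k
    rw [norm_mul, Complex.norm_real, Real.norm_of_nonneg]
    exact mul_nonneg (pow_nonneg ha0.le _) (by linarith)
  have hT : ‖tailDR a f N‖ ≤ ∑' k, ‖f (k + N)‖ * (a ^ (k + N) * (1 - a)) := by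
    unfold tailDR
    simp only [← hn]
    apply norm_tsum_le_tsum_norm
    simp only [hn]
    exact S1
  set B := ∑' k, ‖f (k + N)‖ * (a ^ (k + N) * (1 - a))
  set Q := ∑' k, ‖f (k + N)‖ ^ 2 * (a ^ (k + N) * (1 - a))
  have HH := (H2.sub (H1.mul_left (2 * (B / a ^ N)))).add (H0.mul_left ((B / a ^ N) ^ 2))
  have h0 := HH.nonneg (fun k => by
    have : 0 ≤ (‖f (k + N)‖ - B / a ^ N) ^ 2 * (a ^ (k + N) * (1 - a)) :=
      mul_nonneg (sq_nonneg _) (mul_nonneg (pow_nonneg ha0.le _) (by linarith))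
    change 0 ≤ _
    nlinarith [this])
  have e : Q - 2 * (B / a ^ N) * B + (B / a ^ N) ^ 2 * a ^ N = Q - B ^ 2 / a ^ N := by
    field_simp
    ring
  rw [e] at h0
  have : ‖tailDR a f N‖ ^ 2 / a ^ N ≤ B ^ 2 / a ^ N := by gcongr
  linarith

/-- **Plancherel theorem on the Dunkl–Ramirez hypergroup `H_a`.**
For every `f : ℕ → ℂ` with `Σ_k |f(k)|² aᵏ(1-a) < ∞` one has
`|f̂(0)|² + Σ_{n ≥ 1} (1-a) a^{-n} |f̂(n)|² = Σ_k |f(k)|² aᵏ(1-a)`. -/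
theorem plancherel_dunkl_ramirez
    (a : ℝ) (ha0 : 0 < a) (ha : a ≤ 1 / 2)
    (f : ℕ → ℂ)
    (hf : (∑' k : ℕ, (ENNReal.ofReal ‖f k‖) ^ (2:ℕ) *
        ENNReal.ofReal (a ^ k * (1 - a))) ≠ ∞) :
    (ENNReal.ofReal ‖fourierCoeffDR a f 0‖) ^ (2:ℕ) +
        ∑' n : ℕ, ENNReal.ofReal ((1 - a) / a ^ (n + 1)) *
          (ENNReal.ofReal ‖fourierCoeffDR a f (n + 1)‖) ^ (2:ℕ)
      = ∑' k : ℕ, (ENNReal.ofReal ‖f k‖) ^ (2:ℕ) *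
          ENNReal.ofReal (a ^ k * (1 - a)) := by
  have ha1 : a < 1 := by linarith
  have hw : ∀ k : ℕ, 0 ≤ a ^ k * (1 - a) := fun k =>
    mul_nonneg (pow_nonneg ha0.le _) (by linarith)
  have hw2 : ∀ k : ℕ, 0 ≤ ‖f k‖ ^ 2 * (a ^ k * (1 - a)) := fun k =>
    mul_nonneg (sq_nonneg _) (hw k)
  have hE : ∀ k, (ENNReal.ofReal ‖f k‖) ^ (2:ℕ) * ENNReal.ofReal (a ^ k * (1 - a))
      = ENNReal.ofReal (‖f k‖ ^ 2 * (a ^ k * (1 - a))) := by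
    intro k
    rw [ENNReal.ofReal_mul (sq_nonneg _), ENNReal.ofReal_pow (norm_nonneg _)]
  simp only [hE] at hf ⊢
  have h2 : Summable fun k => ‖f k‖ ^ 2 * (a ^ k * (1 - a)) := by
    have := ENNReal.summable_toReal hf
    simpa only [ENNReal.toReal_ofReal (hw2 _)] using this
  have h0 : Summable fun k : ℕ => a ^ k * (1 - a) :=
    (summable_geometric_of_lt_one ha0.le ha1).mul_right _
  have h1 : Summable fun k => ‖f k‖ * (a ^ k * (1 - a)) := by
    refine Summable.of_nonneg_of_le (fun k => mul_nonneg (norm_nonneg _) (hw k)) ?_ (h2.add h0)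
    intro k
    have : 0 ≤ (‖f k‖ ^ 2 + 1 - ‖f k‖) * (a ^ k * (1 - a)) :=
      mul_nonneg (by nlinarith [sq_nonneg (‖f k‖ - 1), norm_nonneg (f k)]) (hw k)
    linarith
  have hs : Summable fun k => f k * ((a ^ k * (1 - a) : ℝ) : ℂ) := by
    apply Summable.of_norm
    refine h1.congr ?_
    intro k
    rw [norm_mul, Complex.norm_real, Real.norm_of_nonneg (hw k)]
  have hF : ∀ n : ℕ, 0 ≤ (1 - a) / a ^ (n + 1) * ‖fourierCoeffDR a f (n + 1)‖ ^ 2 := fun n =>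
    mul_nonneg (div_nonneg (by linarith) (pow_nonneg ha0.le _)) (sq_nonneg _)
  have hrem : Filter.Tendsto (fun N => ‖tailDR a f N‖ ^ 2 / a ^ N) Filter.atTop (nhds 0) :=
    squeeze_zero (fun N => div_nonneg (sq_nonneg _) (pow_nonneg ha0.le _))
      (remDR a ha0 ha1 f h2 h1)
      (tendsto_sum_nat_add fun k => ‖f k‖ ^ 2 * (a ^ k * (1 - a)))
  have hsum : HasSum (fun n : ℕ => (1 - a) / a ^ (n + 1) * ‖fourierCoeffDR a f (n + 1)‖ ^ 2)
      (∑' k, ‖f k‖ ^ 2 * (a ^ k * (1 - a)) - ‖fourierCoeffDR a f 0‖ ^ 2) := by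
    rw [hasSum_iff_tendsto_nat_of_nonneg hF]
    have ht := (h2.hasSum.tendsto_sum_nat.add hrem).sub_const (‖fourierCoeffDR a f 0‖ ^ 2)
    rw [add_zero] at ht
    refine ht.congr ?_
    intro N
    have := partialDR a ha0 ha1 f hs N
    linarith
  have hG : ∀ n : ℕ, ENNReal.ofReal ((1 - a) / a ^ (n + 1)) *
      (ENNReal.ofReal ‖fourierCoeffDR a f (n + 1)‖) ^ (2:ℕ)
      = ENNReal.ofReal ((1 - a) / a ^ (n + 1) * ‖fourierCoeffDR a f (n + 1)‖ ^ 2) := by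
    intro n
    rw [ENNReal.ofReal_mul (div_nonneg (by linarith) (pow_nonneg ha0.le _)),
      ENNReal.ofReal_pow (norm_nonneg _)]
  simp only [hG]
  rw [← ENNReal.ofReal_tsum_of_nonneg hF hsum.summable, ← ENNReal.ofReal_tsum_of_nonneg hw2 h2,
    ← ENNReal.ofReal_pow (norm_nonneg _),
    ← ENNReal.ofReal_add (sq_nonneg _) (tsum_nonneg hF), hsum.tsum_eq]
  congr 1
  ring
end

section
/- Let ι be a countable type, k : ι → [0,∞), and φ : ι → (0,∞). If M := sup_{t>0} t · Σ_{i ∈ ι : φ(i) ≥ t} k(i)² is finite, then for every w > 0 one has Σ_{i ∈ ι : φ(i) ≤ w} φ(i)² k(i)² ≤ 2 · M · w. -/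
open ENNReal

open MeasureTheory in
theorem paley_aux_sq (a : ℝ) (ha : 0 < a) :
    (ENNReal.ofReal a) ^ (2:ℕ) = ∫⁻ t in Set.Ioc 0 a, ENNReal.ofReal (2 * t) := by
  rw [← ofReal_integral_eq_lintegral_ofReal]
  · rw [← intervalIntegral.integral_of_le ha.le, intervalIntegral.integral_const_mul, integral_id,
      ← ENNReal.ofReal_pow ha.le]
    congr 1
    ring
  · exact (by fun_prop : Continuous fun t : ℝ => 2 * t).integrableOn_Ioc
  · filter_upwards [ae_restrict_mem measurableSet_Ioc] with t ht
    have := ht.1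
    simp only [Pi.zero_apply]
    linarith

/-- Key intermediate claim in the proof of the Paley inequality on compact hypergroups:
if `M := sup_{t>0} t · Σ_{i : φ(i) ≥ t} k(i)²` is finite, then for every `w > 0` one has
`Σ_{i : φ(i) ≤ w} φ(i)² k(i)² ≤ 2 M w` (sums taken in `[0,∞]`). -/
theorem paley_key_estimate
    (ι : Type*) [Countable ι]
    (k : ι → ℝ) (hk : ∀ i, 0 ≤ k i)
    (φ : ι → ℝ) (hφ : ∀ i, 0 < φ i)
    (M : ℝ≥0∞)
    (hM : M = ⨆ t ∈ Set.Ioi (0:ℝ), ENNReal.ofReal t *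
        ∑' i : {i : ι // t ≤ φ i}, (ENNReal.ofReal (k i.1)) ^ (2:ℕ))
    (hMfin : M ≠ ∞) :
    ∀ w : ℝ, 0 < w →
      ∑' i : {i : ι // φ i ≤ w},
          (ENNReal.ofReal (φ i.1)) ^ (2:ℕ) * (ENNReal.ofReal (k i.1)) ^ (2:ℕ)
        ≤ 2 * M * ENNReal.ofReal w := by
  intro w hw
  have key : ∀ i : {i : ι // φ i ≤ w},
      (ENNReal.ofReal (φ i.1)) ^ (2:ℕ) * (ENNReal.ofReal (k i.1)) ^ (2:ℕ)
      = ∫⁻ t in Set.Ioc 0 w, (Set.Iic (φ i.1)).indicator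
          (fun t => ENNReal.ofReal (2 * t) * (ENNReal.ofReal (k i.1)) ^ (2:ℕ)) t := by
    rintro ⟨i, hi⟩
    have hs : Set.Iic (φ i) ∩ Set.Ioc 0 w = Set.Ioc 0 (φ i) := by
      ext t
      simp only [Set.mem_inter_iff, Set.mem_Iic, Set.mem_Ioc]
      constructor
      · rintro ⟨h1, h2, h3⟩
        exact ⟨h2, h1⟩
      · rintro ⟨h1, h2⟩
        exact ⟨h2, h1, h2.trans hi⟩
    rw [MeasureTheory.lintegral_indicator measurableSet_Iic,
      MeasureTheory.Measure.restrict_restrict measurableSet_Iic, hs,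
      MeasureTheory.lintegral_mul_const _ (by fun_prop), paley_aux_sq _ (hφ i)]
  simp_rw [key]
  rw [← MeasureTheory.lintegral_tsum]
  · calc _ ≤ ∫⁻ t in Set.Ioc 0 w, 2 * M := by
          refine MeasureTheory.setLIntegral_mono measurable_const ?_
          intro t ht
          have h1 : ENNReal.ofReal t *
              ∑' i : {i : ι // t ≤ φ i}, (ENNReal.ofReal (k i.1)) ^ (2:ℕ) ≤ M := by
            rw [hM]
            exact le_iSup₂ (f := fun t (_ : t ∈ Set.Ioi (0:ℝ)) => ENNReal.ofReal t *
              ∑' i : {i : ι // t ≤ φ i}, (ENNReal.ofReal (k i.1)) ^ (2:ℕ)) t ht.1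
          refine (ENNReal.tsum_comp_le_tsum_of_injective Subtype.val_injective
            (fun i : ι => (Set.Iic (φ i)).indicator
              (fun t => ENNReal.ofReal (2 * t) * (ENNReal.ofReal (k i)) ^ (2:ℕ)) t)).trans ?_
          refine le_trans (le_of_eq ?_) (mul_le_mul_right h1 2)
          have h2 := tsum_subtype {i : ι | t ≤ φ i} (fun i => (ENNReal.ofReal (k i)) ^ (2:ℕ))
          have h3 : ∑' i : {i : ι // t ≤ φ i}, (ENNReal.ofReal (k i.1)) ^ (2:ℕ) = _ := h2
          rw [h3, ← mul_assoc, ← ENNReal.tsum_mul_left]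
          refine tsum_congr fun i => ?_
          by_cases h : t ≤ φ i
          · simp [Set.indicator, h, ENNReal.ofReal_mul]
          · simp [Set.indicator, h]
      _ = _ := by simp
  · intro i
    exact (Measurable.indicator (by fun_prop) measurableSet_Iic).aemeasurable
end
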